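/- (Per-model core of Theorem 1.) Let F ∈ ℝ^{n×n}, H ∈ ℝ^{m×n}, let Q, P₀ ∈ ℝ^{n×n} and R ∈ ℝ^{m×m} be symmetric positive definite, let γ > 0, let x̂₀ ∈ ℝⁿ, measurements y₀,…,y_{N−1} ∈ ℝ^m, and define P_t, x̆_t, c_t by the Kalman recursions (see context). If H P_N Hᵀ ≺ γ² I, then for every ŷ ∈ ℝ^m the supremum over all state trajectories x : {0,…,N} → ℝⁿ of [ |ŷ − H x_N|² − γ² ( |x₀ − x̂₀|²_{P₀⁻¹} + Σ_{t=0}^{N−1} ( |x_{t+1} − F x_t|²_{Q⁻¹} + |y_t − H x_t|²_{R⁻¹} ) ) ] is attained and equals |ŷ − H x̆_N|²_{(I − γ⁻² H P_N Hᵀ)⁻¹} − γ² c_N. -/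

import Mathlib

open Matrix

/-- Weighted squared norm `|z|²_M = zᵀ M z`. -/
noncomputable def qf {k : ℕ} (M : Matrix (Fin k) (Fin k) ℝ) (z : Fin k → ℝ) : ℝ :=
  z ⬝ᵥ M *ᵥ z

section QuadraticForm

variable {k l : ℕ}

theorem qf_nonneg {M : Matrix (Fin k) (Fin k) ℝ} (hM : M.PosSemidef) (z : Fin k → ℝ) :
    0 ≤ qf M z := by
  simpa [qf] using hM.dotProduct_mulVec_nonneg z

theorem qf_zero (M : Matrix (Fin k) (Fin k) ℝ) : qf M 0 = 0 := by
  simp [qf]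

theorem qf_smul (a : ℝ) (M : Matrix (Fin k) (Fin k) ℝ) (z : Fin k → ℝ) :
    qf (a • M) z = a * qf M z := by
  simp [qf, smul_mulVec]

theorem qf_add_left (M M' : Matrix (Fin k) (Fin k) ℝ) (z : Fin k → ℝ) :
    qf (M + M') z = qf M z + qf M' z := by
  simp [qf, add_mulVec]

theorem qf_sub_left (M M' : Matrix (Fin k) (Fin k) ℝ) (z : Fin k → ℝ) :
    qf (M - M') z = qf M z - qf M' z := by
  simp [qf, sub_mulVec]

theorem qf_neg (M : Matrix (Fin k) (Fin k) ℝ) (z : Fin k → ℝ) : qf M (-z) = qf M z := by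
  simp [qf, mulVec_neg]

theorem qf_mulVec (M : Matrix (Fin k) (Fin k) ℝ) (B : Matrix (Fin k) (Fin l) ℝ)
    (z : Fin l → ℝ) : qf M (B *ᵥ z) = qf (Bᵀ * M * B) z := by
  simp only [qf, ← mulVec_mulVec, dotProduct_mulVec, vecMul_transpose]

theorem dotProduct_mulVec_eq_transpose (B : Matrix (Fin k) (Fin l) ℝ) (u : Fin k → ℝ)
    (v : Fin l → ℝ) : u ⬝ᵥ B *ᵥ v = v ⬝ᵥ Bᵀ *ᵥ u := by
  rw [dotProduct_mulVec, mulVec_transpose, dotProduct_comm]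

theorem qf_sub {M : Matrix (Fin k) (Fin k) ℝ} (hM : M.IsSymm) (u v : Fin k → ℝ) :
    qf M (u - v) = qf M u - 2 * (u ⬝ᵥ M *ᵥ v) + qf M v := by
  have h : v ⬝ᵥ M *ᵥ u = u ⬝ᵥ M *ᵥ v := by
    rw [dotProduct_mulVec_eq_transpose, hM.eq]
  simp only [qf, mulVec_sub, dotProduct_sub, sub_dotProduct, h]
  ring

end QuadraticForm

section CompleteSquare

variable {k l : ℕ} {S : Matrix (Fin k) (Fin k) ℝ} {T : Matrix (Fin l) (Fin l) ℝ}
  {A : Matrix (Fin l) (Fin k) ℝ}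

theorem information_mul_gain (hS : IsUnit S.det) (hT : IsUnit T.det)
    (hD : IsUnit (T + A * S * Aᵀ).det) :
    (S⁻¹ + Aᵀ * T⁻¹ * A) * (S * Aᵀ * (T + A * S * Aᵀ)⁻¹) = Aᵀ * T⁻¹ := by
  have h : (S⁻¹ + Aᵀ * T⁻¹ * A) * (S * Aᵀ) = Aᵀ * T⁻¹ * (T + A * S * Aᵀ) := by
    rw [Matrix.add_mul, Matrix.mul_add, ← Matrix.mul_assoc S⁻¹, nonsing_inv_mul S hS, Matrix.one_mul,
      Matrix.mul_assoc Aᵀ T⁻¹ T, nonsing_inv_mul T hT, Matrix.mul_one]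
    simp only [Matrix.mul_assoc]
  rw [← Matrix.mul_assoc, h, Matrix.mul_assoc, mul_nonsing_inv _ hD, Matrix.mul_one]

theorem information_mul_covariance (hS : IsUnit S.det) (hT : IsUnit T.det)
    (hD : IsUnit (T + A * S * Aᵀ).det) :
    (S⁻¹ + Aᵀ * T⁻¹ * A) * (S - S * Aᵀ * (T + A * S * Aᵀ)⁻¹ * (A * S)) = 1 := by
  rw [Matrix.mul_sub, ← Matrix.mul_assoc _ _ (A * S), information_mul_gain hS hT hD, Matrix.add_mul,
    nonsing_inv_mul S hS]
  simp only [Matrix.mul_assoc, add_sub_cancel_right]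

theorem qf_add_qf_sub_mulVec (hS : IsUnit S.det) (hT : IsUnit T.det)
    (hD : IsUnit (T + A * S * Aᵀ).det) (hSs : S.IsSymm) (hTs : T.IsSymm)
    (e : Fin k → ℝ) (z : Fin l → ℝ) :
    qf S⁻¹ e + qf T⁻¹ (z - A *ᵥ e) =
      qf (S⁻¹ + Aᵀ * T⁻¹ * A) (e - (S * Aᵀ * (T + A * S * Aᵀ)⁻¹) *ᵥ z) +
        qf (T + A * S * Aᵀ)⁻¹ z := by
  have hMK := information_mul_gain hS hT hD
  have hSi : (S⁻¹)ᵀ = S⁻¹ := by rw [transpose_nonsing_inv, hSs.eq]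
  have hTi : (T⁻¹)ᵀ = T⁻¹ := by rw [transpose_nonsing_inv, hTs.eq]
  have hDi : ((T + A * S * Aᵀ)⁻¹)ᵀ = (T + A * S * Aᵀ)⁻¹ := by
    rw [transpose_nonsing_inv]
    simp [transpose_add, transpose_mul, hSs.eq, hTs.eq, Matrix.mul_assoc]
  have hM : (S⁻¹ + Aᵀ * T⁻¹ * A).IsSymm := by
    simp [Matrix.IsSymm, transpose_add, transpose_mul, hSi, hTi, Matrix.mul_assoc]
  have hK : (S * Aᵀ * (T + A * S * Aᵀ)⁻¹)ᵀ * (Aᵀ * T⁻¹) = T⁻¹ - (T + A * S * Aᵀ)⁻¹ := by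
    have h1 : A * S * Aᵀ = (T + A * S * Aᵀ) - T := by abel
    calc (S * Aᵀ * (T + A * S * Aᵀ)⁻¹)ᵀ * (Aᵀ * T⁻¹)
        = (T + A * S * Aᵀ)⁻¹ * (A * S * Aᵀ) * T⁻¹ := by
          rw [transpose_mul, hDi, transpose_mul, hSs.eq, transpose_transpose]
          simp only [Matrix.mul_assoc]
      _ = (T + A * S * Aᵀ)⁻¹ * ((T + A * S * Aᵀ) - T) * T⁻¹ := by rw [← h1]
      _ = T⁻¹ - (T + A * S * Aᵀ)⁻¹ := by
          rw [mul_sub, sub_mul, nonsing_inv_mul _ hD, Matrix.one_mul, Matrix.mul_assoc,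
            mul_nonsing_inv _ hT, Matrix.mul_one]
  rw [qf_sub hTi, qf_sub hM, qf_mulVec, qf_mulVec, Matrix.mul_assoc _ _ (S * Aᵀ * _), mulVec_mulVec,
    mulVec_mulVec, hMK, hK, qf_add_left, qf_sub_left, dotProduct_mulVec_eq_transpose,
    transpose_mul, hTi]
  ring

end CompleteSquare

section PositiveDefinite

variable {k l : ℕ} {S : Matrix (Fin k) (Fin k) ℝ} {T : Matrix (Fin l) (Fin l) ℝ}

theorem Matrix.PosDef.isUnit_det (hS : S.PosDef) : IsUnit S.det :=
  hS.det_pos.ne'.isUnit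

theorem Matrix.PosDef.isSymm (hS : S.PosDef) : S.IsSymm :=
  (conjTranspose_eq_transpose_of_trivial S).symm.trans hS.isHermitian.eq

theorem Matrix.PosDef.add_mul_mul_transpose (hS : S.PosDef) (hT : T.PosDef)
    (A : Matrix (Fin l) (Fin k) ℝ) : (T + A * S * Aᵀ).PosDef := by
  have h := hS.posSemidef.mul_mul_conjTranspose_same A
  rw [conjTranspose_eq_transpose_of_trivial] at h
  exact hT.add_posSemidef h

theorem posDef_information (hS : S.PosDef) (hT : T.PosDef) (A : Matrix (Fin l) (Fin k) ℝ) :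
    (S⁻¹ + Aᵀ * T⁻¹ * A).PosDef := by
  simpa using hT.inv.add_mul_mul_transpose hS.inv Aᵀ

theorem inv_information (hS : S.PosDef) (hT : T.PosDef) (A : Matrix (Fin l) (Fin k) ℝ) :
    (S⁻¹ + Aᵀ * T⁻¹ * A)⁻¹ = S - S * Aᵀ * (T + A * S * Aᵀ)⁻¹ * (A * S) :=
  inv_eq_right_inv (information_mul_covariance hS.isUnit_det hT.isUnit_det
    (hS.add_mul_mul_transpose hT A).isUnit_det)

theorem qf_add_qf_sub_mulVec_of_posDef (hS : S.PosDef) (hT : T.PosDef)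
    (A : Matrix (Fin l) (Fin k) ℝ) (e : Fin k → ℝ) (z : Fin l → ℝ) :
    qf S⁻¹ e + qf T⁻¹ (z - A *ᵥ e) =
      qf (S⁻¹ + Aᵀ * T⁻¹ * A) (e - (S * Aᵀ * (T + A * S * Aᵀ)⁻¹) *ᵥ z) +
        qf (T + A * S * Aᵀ)⁻¹ z :=
  qf_add_qf_sub_mulVec hS.isUnit_det hT.isUnit_det
    (hS.add_mul_mul_transpose hT A).isUnit_det hS.isSymm hT.isSymm e z

end PositiveDefinite

section Kalman

variable {n m : ℕ} {F : Matrix (Fin n) (Fin n) ℝ} {H : Matrix (Fin m) (Fin n) ℝ}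
  {Q P P' : Matrix (Fin n) (Fin n) ℝ} {R : Matrix (Fin m) (Fin m) ℝ}

theorem riccati_eq (hP : P.PosDef) (hR : R.PosDef)
    (hP' : P' = Q + F * P * Fᵀ - F * P * Hᵀ * (R + H * P * Hᵀ)⁻¹ * (H * P * Fᵀ)) :
    P' = Q + F * (P⁻¹ + Hᵀ * R⁻¹ * H)⁻¹ * Fᵀ := by
  rw [hP', inv_information hP hR, mul_sub, sub_mul, add_sub_assoc]
  simp only [Matrix.mul_assoc]

theorem riccati_posDef (hP : P.PosDef) (hR : R.PosDef) (hQ : Q.PosDef)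
    (hP' : P' = Q + F * P * Fᵀ - F * P * Hᵀ * (R + H * P * Hᵀ)⁻¹ * (H * P * Fᵀ)) :
    P'.PosDef := by
  rw [riccati_eq hP hR hP']
  exact (posDef_information hP hR H).inv.add_mul_mul_transpose hQ F

/-- One step of forward dynamic programming: the arrival cost plus the stage cost is the next
arrival cost plus a nonnegative square which vanishes for a suitable current state. -/
theorem arrival_cost_step (hP : P.PosDef) (hR : R.PosDef) (hQ : Q.PosDef)
    (hP' : P' = Q + F * P * Fᵀ - F * P * Hᵀ * (R + H * P * Hᵀ)⁻¹ * (H * P * Fᵀ))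
    {b b' : Fin n → ℝ} {y : Fin m → ℝ}
    (hb' : b' = F *ᵥ b + (F * P * Hᵀ * (R + H * P * Hᵀ)⁻¹) *ᵥ (y - H *ᵥ b)) (x' : Fin n → ℝ) :
    ∃ (M : Matrix (Fin n) (Fin n) ℝ) (ξ : Fin n → ℝ), M.PosDef ∧ ∀ x,
      qf P⁻¹ (x - b) + (qf Q⁻¹ (x' - F *ᵥ x) + qf R⁻¹ (y - H *ᵥ x)) =
        qf P'⁻¹ (x' - b') + qf (R + H * P * Hᵀ)⁻¹ (H *ᵥ b - y) + qf M (x - ξ) := by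
  have hW := (posDef_information hP hR H).inv
  have hWW : (P⁻¹ + Hᵀ * R⁻¹ * H)⁻¹⁻¹ = P⁻¹ + Hᵀ * R⁻¹ * H :=
    nonsing_inv_nonsing_inv _ (posDef_information hP hR H).isUnit_det
  have hPeq := riccati_eq hP hR hP'
  set W := (P⁻¹ + Hᵀ * R⁻¹ * H)⁻¹
  set v := (P * Hᵀ * (R + H * P * Hᵀ)⁻¹) *ᵥ (y - H *ᵥ b) with hv
  have hb : b' = F *ᵥ (b + v) := by
    rw [hb', hv, mulVec_add, mulVec_mulVec]
    simp only [Matrix.mul_assoc]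
  refine ⟨W⁻¹ + Fᵀ * Q⁻¹ * F, b + v + (W * Fᵀ * (Q + F * W * Fᵀ)⁻¹) *ᵥ (x' - b'),
    posDef_information hW hQ F, fun x => ?_⟩
  have h1 := qf_add_qf_sub_mulVec_of_posDef hP hR H (x - b) (y - H *ᵥ b)
  have h2 := qf_add_qf_sub_mulVec_of_posDef hW hQ F (x - b - v) (x' - b')
  have e1 : y - H *ᵥ b - H *ᵥ (x - b) = y - H *ᵥ x := by rw [mulVec_sub]; abel
  have e2 : x' - b' - F *ᵥ (x - b - v) = x' - F *ᵥ x := by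
    rw [hb, mulVec_sub, mulVec_sub, mulVec_add]; abel
  rw [e1, ← hWW, ← hv] at h1
  rw [e2, ← hPeq] at h2
  rw [← hPeq, ← neg_sub y, qf_neg, ← sub_sub, ← sub_sub]
  linarith

end Kalman

section Trajectories

variable {n m : ℕ} {F : Matrix (Fin n) (Fin n) ℝ} {H : Matrix (Fin m) (Fin n) ℝ}
  {Q P₀ : Matrix (Fin n) (Fin n) ℝ} {R : Matrix (Fin m) (Fin m) ℝ}
  {xh₀ : Fin n → ℝ} {y : ℕ → Fin m → ℝ} {P : ℕ → Matrix (Fin n) (Fin n) ℝ}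
  {xbr : ℕ → Fin n → ℝ} {c : ℕ → ℝ}

theorem kalman_posDef (hQ : Q.PosDef) (hP₀ : P₀.PosDef) (hR : R.PosDef) (hP0 : P 0 = P₀)
    (hPrec : ∀ t, P (t + 1) =
      Q + F * P t * Fᵀ - F * P t * Hᵀ * (R + H * P t * Hᵀ)⁻¹ * (H * P t * Fᵀ)) (t : ℕ) :
    (P t).PosDef := by
  induction t with
  | zero => rwa [hP0]
  | succ t ih => exact riccati_posDef ih hR hQ (hPrec t)

/-- The least cost of a trajectory arriving at a given state is the quadratic form of the
Kalman filter, and it is attained. -/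
theorem arrival_cost (hQ : Q.PosDef) (hP₀ : P₀.PosDef) (hR : R.PosDef) (hP0 : P 0 = P₀)
    (hPrec : ∀ t, P (t + 1) =
      Q + F * P t * Fᵀ - F * P t * Hᵀ * (R + H * P t * Hᵀ)⁻¹ * (H * P t * Fᵀ))
    (hx0 : xbr 0 = xh₀)
    (hxrec : ∀ t, xbr (t + 1) =
      F *ᵥ xbr t + (F * P t * Hᵀ * (R + H * P t * Hᵀ)⁻¹) *ᵥ (y t - H *ᵥ xbr t))
    (hc0 : c 0 = 0)
    (hcrec : ∀ t, c (t + 1) = c t + qf (R + H * P t * Hᵀ)⁻¹ (H *ᵥ xbr t - y t)) (N : ℕ) :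
    (∀ x : ℕ → Fin n → ℝ, qf (P N)⁻¹ (x N - xbr N) + c N ≤
      qf P₀⁻¹ (x 0 - xh₀) + ∑ t ∈ Finset.range N,
        (qf Q⁻¹ (x (t + 1) - F *ᵥ x t) + qf R⁻¹ (y t - H *ᵥ x t))) ∧
    ∀ ξ : Fin n → ℝ, ∃ x : ℕ → Fin n → ℝ, x N = ξ ∧
      qf P₀⁻¹ (x 0 - xh₀) + ∑ t ∈ Finset.range N,
        (qf Q⁻¹ (x (t + 1) - F *ᵥ x t) + qf R⁻¹ (y t - H *ᵥ x t)) =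
      qf (P N)⁻¹ (ξ - xbr N) + c N := by
  induction N with
  | zero =>
    refine ⟨fun x => by simp [hP0, hx0, hc0], fun ξ => ⟨fun _ => ξ, rfl, ?_⟩⟩
    simp [hP0, hx0, hc0]
  | succ N ih =>
    have hstep := arrival_cost_step (kalman_posDef hQ hP₀ hR hP0 hPrec N) hR hQ (hPrec N) (hxrec N)
    refine ⟨fun x => ?_, fun ξ => ?_⟩
    · obtain ⟨M, η, hM, h⟩ := hstep (x (N + 1))
      have h1 := h (x N)
      have h2 := ih.1 x
      have h3 := qf_nonneg hM.posSemidef (x N - η)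
      rw [Finset.sum_range_succ, hcrec]
      linarith
    · obtain ⟨M, η, -, h⟩ := hstep ξ
      obtain ⟨x, hxN, hx⟩ := ih.2 η
      have h1 := h η
      rw [sub_self, qf_zero] at h1
      refine ⟨Function.update x (N + 1) ξ, Function.update_self .., ?_⟩
      have hlt : ∀ t ≤ N, Function.update x (N + 1) ξ t = x t := fun t ht =>
        Function.update_of_ne (by omega) ..
      have hsum : ∑ t ∈ Finset.range N, (qf Q⁻¹ (Function.update x (N + 1) ξ (t + 1) -
            F *ᵥ Function.update x (N + 1) ξ t) +
            qf R⁻¹ (y t - H *ᵥ Function.update x (N + 1) ξ t)) =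
          ∑ t ∈ Finset.range N, (qf Q⁻¹ (x (t + 1) - F *ᵥ x t) + qf R⁻¹ (y t - H *ᵥ x t)) := by
        refine Finset.sum_congr rfl fun t ht => ?_
        have ht' := Finset.mem_range.mp ht
        rw [hlt t ht'.le, hlt (t + 1) ht']
      rw [Finset.sum_range_succ, hsum, hlt 0 (Nat.zero_le _), hlt N le_rfl, Function.update_self,
        hxN, hcrec]
      linarith

end Trajectories

/-- Maximization over the terminal error: a concave quadratic, completed to a square. -/
theorem terminal_value {n m : ℕ} {P : Matrix (Fin n) (Fin n) ℝ} (hP : P.PosDef)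
    (H : Matrix (Fin m) (Fin n) ℝ) {γ : ℝ} (hγ : 0 < γ)
    (hgam : (γ ^ 2 • (1 : Matrix (Fin m) (Fin m) ℝ) - H * P * Hᵀ).PosDef) (z : Fin m → ℝ) :
    ∃ (M : Matrix (Fin n) (Fin n) ℝ) (η : Fin n → ℝ), M.PosDef ∧ ∀ e,
      (z - H *ᵥ e) ⬝ᵥ (z - H *ᵥ e) - γ ^ 2 * qf P⁻¹ e =
        qf ((1 : Matrix (Fin m) (Fin m) ℝ) - (γ ^ 2)⁻¹ • (H * P * Hᵀ))⁻¹ z -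
          γ ^ 2 * qf M (e - η) := by
  have hg : γ ^ 2 ≠ 0 := by positivity
  set T : Matrix (Fin m) (Fin m) ℝ := -(γ ^ 2) • 1 with hTdef
  have hTmul : T * (-(γ ^ 2)⁻¹ • 1) = 1 := by
    rw [hTdef, smul_mul_smul_comm, Matrix.one_mul, neg_mul_neg, mul_inv_cancel₀ hg, one_smul]
  have hTinv : T⁻¹ = -(γ ^ 2)⁻¹ • 1 := inv_eq_right_inv hTmul
  have hT : IsUnit T.det := isUnit_det_of_right_inverse hTmul
  have hTs : T.IsSymm := by simp [hTdef, Matrix.IsSymm]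
  have hDG : T + H * P * Hᵀ = -(γ ^ 2 • 1 - H * P * Hᵀ) := by
    rw [hTdef, neg_smul]; abel
  have hG := hgam.isUnit_det
  have hDmul : (T + H * P * Hᵀ) * (-(γ ^ 2 • 1 - H * P * Hᵀ)⁻¹) = 1 := by
    rw [hDG, neg_mul_neg, mul_nonsing_inv _ hG]
  have hDinv := inv_eq_right_inv hDmul
  have hD : IsUnit (T + H * P * Hᵀ).det := isUnit_det_of_right_inverse hDmul
  have hval : (1 - (γ ^ 2)⁻¹ • (H * P * Hᵀ))⁻¹ = γ ^ 2 • (γ ^ 2 • 1 - H * P * Hᵀ)⁻¹ := by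
    refine inv_eq_right_inv ?_
    have h : 1 - (γ ^ 2)⁻¹ • (H * P * Hᵀ) = (γ ^ 2)⁻¹ • (γ ^ 2 • 1 - H * P * Hᵀ) := by
      rw [smul_sub, smul_smul, inv_mul_cancel₀ hg, one_smul]
    rw [h, smul_mul_smul_comm, inv_mul_cancel₀ hg, mul_nonsing_inv _ hG, one_smul]
  have hM : (P⁻¹ + Hᵀ * T⁻¹ * H).PosDef := by
    have hMW := information_mul_covariance (A := H) hP.isUnit_det hT hD
    rw [← inv_eq_left_inv hMW]
    refine Matrix.PosDef.inv ?_
    have h := hgam.inv.add_mul_mul_transpose hP (P * Hᵀ)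
    rwa [transpose_mul, transpose_transpose, hP.isSymm.eq, ← sub_neg_eq_add, ← Matrix.neg_mul,
      ← Matrix.mul_neg, ← hDinv] at h
  refine ⟨_, (P * Hᵀ * (T + H * P * Hᵀ)⁻¹) *ᵥ z, hM, fun e => ?_⟩
  have h := qf_add_qf_sub_mulVec hP.isUnit_det hT hD hP.isSymm hTs e z
  have h1 : qf T⁻¹ (z - H *ᵥ e) = -(γ ^ 2)⁻¹ * ((z - H *ᵥ e) ⬝ᵥ (z - H *ᵥ e)) := by
    rw [hTinv, qf_smul, qf, one_mulVec]
  have h2 : qf (T + H * P * Hᵀ)⁻¹ z = -qf (γ ^ 2 • 1 - H * P * Hᵀ)⁻¹ z := by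
    rw [hDinv, ← neg_one_smul ℝ, qf_smul, neg_one_mul]
  rw [h1, h2] at h
  rw [hval, qf_smul]
  have h3 := congrArg (γ ^ 2 * ·) h
  simp only [mul_add, neg_mul, mul_neg, mul_inv_cancel_left₀ hg] at h3
  linarith

/-- (Per-model core of Theorem 1.) If `H P_N Hᵀ ≺ γ² I`, then for every `ŷ` the
supremum over state trajectories of
`|ŷ − H x_N|² − γ² (|x₀ − x̂₀|²_{P₀⁻¹} + Σ_t (|x_{t+1} − F x_t|²_{Q⁻¹} + |y_t − H x_t|²_{R⁻¹}))`
is attained and equals `|ŷ − H x̆_N|²_{(I − γ⁻² H P_N Hᵀ)⁻¹} − γ² c_N`. -/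
theorem per_model_core {n m N : ℕ}
    (F : Matrix (Fin n) (Fin n) ℝ) (H : Matrix (Fin m) (Fin n) ℝ)
    (Q P₀ : Matrix (Fin n) (Fin n) ℝ) (R : Matrix (Fin m) (Fin m) ℝ)
    (hQ : Q.PosDef) (hP₀ : P₀.PosDef) (hR : R.PosDef)
    (γ : ℝ) (hγ : 0 < γ)
    (xh₀ : Fin n → ℝ) (y : ℕ → Fin m → ℝ)
    (P : ℕ → Matrix (Fin n) (Fin n) ℝ)
    (xbr : ℕ → Fin n → ℝ) (c : ℕ → ℝ)
    (hP0 : P 0 = P₀)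
    (hPrec : ∀ t, P (t + 1) =
      Q + F * P t * Fᵀ - F * P t * Hᵀ * (R + H * P t * Hᵀ)⁻¹ * (H * P t * Fᵀ))
    (hx0 : xbr 0 = xh₀)
    (hxrec : ∀ t, xbr (t + 1) =
      F *ᵥ xbr t + (F * P t * Hᵀ * (R + H * P t * Hᵀ)⁻¹) *ᵥ (y t - H *ᵥ xbr t))
    (hc0 : c 0 = 0)
    (hcrec : ∀ t, c (t + 1) = c t + qf (R + H * P t * Hᵀ)⁻¹ (H *ᵥ xbr t - y t))
    (hgam : (γ ^ 2 • (1 : Matrix (Fin m) (Fin m) ℝ) - H * P N * Hᵀ).PosDef)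
    (yh : Fin m → ℝ) :
    IsGreatest
      (Set.range fun x : ℕ → Fin n → ℝ =>
        (yh - H *ᵥ x N) ⬝ᵥ (yh - H *ᵥ x N) -
          γ ^ 2 * (qf P₀⁻¹ (x 0 - xh₀) +
            ∑ t ∈ Finset.range N,
              (qf Q⁻¹ (x (t + 1) - F *ᵥ x t) + qf R⁻¹ (y t - H *ᵥ x t))))
      (qf ((1 : Matrix (Fin m) (Fin m) ℝ) - (γ ^ 2)⁻¹ • (H * P N * Hᵀ))⁻¹
          (yh - H *ᵥ xbr N) -
        γ ^ 2 * c N) := by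
  obtain ⟨hle, hex⟩ := arrival_cost hQ hP₀ hR hP0 hPrec hx0 hxrec hc0 hcrec N
  obtain ⟨M, η, hM, h⟩ := terminal_value (kalman_posDef hQ hP₀ hR hP0 hPrec N) H hγ hgam
    (yh - H *ᵥ xbr N)
  have hres : ∀ ξ, yh - H *ᵥ xbr N - H *ᵥ (ξ - xbr N) = yh - H *ᵥ ξ := fun ξ => by
    rw [mulVec_sub]; abel
  constructor
  · obtain ⟨x, hxN, hx⟩ := hex (xbr N + η)
    refine ⟨x, ?_⟩
    have h1 := h (xbr N + η - xbr N)
    rw [hres, add_sub_cancel_left, sub_self, qf_zero] at h1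
    rw [add_sub_cancel_left] at hx
    simp only [hx, hxN]
    linarith
  · rintro _ ⟨x, rfl⟩
    have h1 := h (x N - xbr N)
    rw [hres] at h1
    have h2 := mul_le_mul_of_nonneg_left (hle x) (sq_nonneg γ)
    have h3 := mul_nonneg (sq_nonneg γ) (qf_nonneg hM.posSemidef (x N - xbr N - η))
    dsimp only
    linarith
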